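/- Let G be a finite group and H a subgroup of G. If there exists a Sylow 2-subgroup of H which is a perfect code of G, then H is a perfect code of G. -/

import Mathlib

/-- A subgroup `H` of a finite group `G` is a *perfect code* of `G` if there exists a subset
`T` of `G` that is inverse-closed and is a right transversal of `H` in `G` (i.e., every element
of `G` can be written uniquely as `h * t` with `h ∈ H` and `t ∈ T`). -/
def Subgroup.IsPerfectCode {G : Type*} [Group G] (H : Subgroup G) : Prop :=
  ∃ T : Set G, T⁻¹ = T ∧ Subgroup.IsComplement (H : Set G) T

open Function Subgroup
open scoped Pointwise

/-- A finite type carries an involution all of whose fixed points satisfy `P`, as soon as `P` is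
satisfiable when the cardinality is odd. -/
theorem exists_involutive_forall_fixed {α : Type*} [Finite α] (P : α → Prop)
    (h : Odd (Nat.card α) → ∃ a, P a) :
    ∃ σ : α → α, Involutive σ ∧ ∀ a, σ a = a → P a := by
  have key : ∀ e : α ≃ Fin (Nat.card α), Involutive fun x ↦ e.symm (e x).rev := fun e x ↦ by simp
  have fixed : ∀ (e : α ≃ Fin (Nat.card α)) (x : α), e.symm (e x).rev = x →
      2 * (e x : ℕ) + 1 = Nat.card α := fun e x hx ↦ by
    have h1 := congrArg Fin.val ((Equiv.symm_apply_eq e).1 hx)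
    rw [Fin.val_rev] at h1
    have := (e x).isLt
    omega
  by_cases hodd : Odd (Nat.card α)
  · obtain ⟨a, ha⟩ := h hodd
    obtain ⟨k, hk⟩ := hodd
    let e := (Finite.equivFin α).trans
      (Equiv.swap (Finite.equivFin α a) ⟨k, by omega⟩)
    refine ⟨_, key e, fun x hx ↦ ?_⟩
    have h1 := fixed e x hx
    have h2 : (e a : ℕ) = k := by simp [e]
    have h3 : x = a := e.injective (Fin.ext (by omega))
    exact h3 ▸ ha
  · refine ⟨_, key (Finite.equivFin α), fun x hx ↦ absurd ⟨_, (fixed _ x hx).symm⟩ hodd⟩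

/-- An involution of a set `β` lifts along a map `π : α → β` to an involution of `α` whose fixed
points satisfy `P`, if exchanged fibres have equal cardinality and `P` holds somewhere on every
invariant fibre of odd cardinality. -/
theorem exists_involutive_lift {α β : Type*} [Finite α] (π : α → β) {ι : β → β}
    (hι : Involutive ι) (P : α → Prop)
    (hcard : ∀ b, Nat.card {a // π a = b} = Nat.card {a // π a = ι b})
    (hodd : ∀ b, ι b = b → Odd (Nat.card {a // π a = b}) → ∃ a, π a = b ∧ P a) :
    ∃ σ : α → α, Involutive σ ∧ (∀ a, π (σ a) = ι (π a)) ∧ ∀ a, σ a = a → P a := by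
  classical
  have local_lift : ∀ z : Sym2 β, ∃ τ : α → α, ∀ a, s(π a, ι (π a)) = z →
      τ (τ a) = a ∧ π (τ a) = ι (π a) ∧ (τ a = a → P a) := by
    intro z
    by_cases hz : ∃ b, s(b, ι b) = z
    swap
    · exact ⟨id, fun a ha ↦ absurd ⟨_, ha⟩ hz⟩
    obtain ⟨b, rfl⟩ := hz
    have fibre : ∀ a, s(π a, ι (π a)) = s(b, ι b) → π a = b ∨ π a = ι b := fun a ha ↦ by
      rcases Sym2.eq_iff.1 ha with h | h
      exacts [.inl h.1, .inr h.1]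
    by_cases hb : ι b = b
    · obtain ⟨σ, hσ, hP⟩ := exists_involutive_forall_fixed
        (fun a : {a // π a = b} ↦ P a) fun h ↦ by
          obtain ⟨a, ha, hPa⟩ := hodd b hb h
          exact ⟨⟨a, ha⟩, hPa⟩
      refine ⟨fun a ↦ if h : π a = b then σ ⟨a, h⟩ else a, fun a ha ↦ ?_⟩
      have h : π a = b := by simpa [hb] using fibre a ha
      have h' := (σ ⟨a, h⟩).2
      refine ⟨?_, ?_, ?_⟩
      · simp [h, h', hσ _]
      · simp [h, h', hb]
      · simp only [h, dif_pos]
        exact fun h1 ↦ hP _ (Subtype.ext h1)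
    · let e : {a // π a = b} ≃ {a // π a = ι b} := (Finite.card_eq.1 (hcard b)).some
      refine ⟨fun a ↦ if h : π a = b then e ⟨a, h⟩ else
        if h : π a = ι b then e.symm ⟨a, h⟩ else a, fun a ha ↦ ?_⟩
      have proj : ∀ (x : α), π x = ι (π a) → x = a → P a := fun x hx hxa ↦ by
        rw [hxa] at hx
        rcases fibre a ha with h | h
        · exact absurd (by rw [← h, ← hx]) hb
        · rw [h, hι] at hx
          exact absurd hx hb
      rcases fibre a ha with h | h
      · have h' := (e ⟨a, h⟩).2
        refine ⟨by simp [h, h', hb], by simp [h, h'], proj _ (by simp [h, h'])⟩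
      · have h' := (e.symm ⟨a, h⟩).2
        refine ⟨by simp [h, h', hb], by simp [h, h', hb, hι b], proj _ (by simp [h, h', hb, hι b])⟩
  choose τ hτ using local_lift
  have swap : ∀ a, s(π (τ s(π a, ι (π a)) a), ι (π (τ s(π a, ι (π a)) a))) = s(π a, ι (π a)) :=
    fun a ↦ by rw [(hτ _ a rfl).2.1, hι, Sym2.eq_swap]
  refine ⟨fun a ↦ τ s(π a, ι (π a)) a, fun a ↦ ?_, fun a ↦ (hτ _ a rfl).2.1,
    fun a ↦ (hτ _ a rfl).2.2⟩
  simp only [swap]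
  exact (hτ _ a rfl).1

/-- If `σ` is an involution of `α` and `c : G → α` is such that every pair `(a, σ a)` has the form
`(c g, c g⁻¹)`, with `g` an involution when `σ a = a`, then `c` has a section intertwining
`σ` and inversion. -/
theorem exists_section_inv {G α : Type*} [Group G] (c : G → α) {σ : α → α} (hσ : Involutive σ)
    (hc : ∀ a, ∃ g, c g = a ∧ c g⁻¹ = σ a)
    (hfix : ∀ a, σ a = a → ∃ g, g⁻¹ = g ∧ c g = a) :
    ∃ t : α → G, (∀ a, c (t a) = a) ∧ ∀ a, t (σ a) = (t a)⁻¹ := by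
  classical
  have local_section : ∀ z : Sym2 α, ∃ t : α → G, ∀ a, s(a, σ a) = z →
      c (t a) = a ∧ t (σ a) = (t a)⁻¹ := by
    intro z
    by_cases hz : ∃ b, s(b, σ b) = z
    swap
    · exact ⟨1, fun a ha ↦ absurd ⟨_, ha⟩ hz⟩
    obtain ⟨b, rfl⟩ := hz
    by_cases hb : σ b = b
    · obtain ⟨g, hg, hgb⟩ := hfix b hb
      refine ⟨fun _ ↦ g, fun a ha ↦ ?_⟩
      have : a = b := by
        rcases Sym2.eq_iff.1 ha with h | h
        exacts [h.1, h.1.trans hb]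
      exact ⟨this ▸ hgb, hg.symm⟩
    · obtain ⟨g, hg, hg'⟩ := hc b
      refine ⟨fun a ↦ if a = b then g else g⁻¹, fun a ha ↦ ?_⟩
      rcases Sym2.eq_iff.1 ha with h | h
      · simp [h.1, hb, hg]
      · simp [h.1, hb, hg', hσ b]
  choose τ hτ using local_section
  refine ⟨fun a ↦ τ s(a, σ a) a, fun a ↦ (hτ _ a rfl).1, fun a ↦ ?_⟩
  simp only [hσ a]
  rw [Sym2.eq_swap, (hτ _ a rfl).2]

namespace Subgroup.IsComplement

variable {G : Type*} [Group G] {H : Subgroup G} {T : Set G}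

/-- A fibre of a left `H`-invariant map is `|H|` times as large as its intersection with a right
transversal of `H`. -/
theorem card_fibre_eq_mul {β : Type*} (hT : IsComplement (H : Set G) T) (p : G → β)
    (hp : ∀ h ∈ H, ∀ g, p (h * g) = p g) (b : β) :
    Nat.card {g // p g = b} = Nat.card H * Nat.card {t : T // p t = b} := by
  rw [← Nat.card_prod]
  refine Nat.card_congr ?_
  calc {g // p g = b} ≃ {x : H × T // p x.2 = b} :=
        hT.equiv.subtypeEquiv fun g ↦ by
          conv_lhs => rw [← hT.equiv_fst_mul_equiv_snd g]
          rw [hp _ (hT.equiv g).1.2]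
    _ ≃ H × {t : T // p t = b} :=
        { toFun x := (x.1.1, ⟨x.1.2, x.2⟩)
          invFun x := ⟨(x.1, x.2.1), x.2.2⟩
          left_inv _ := rfl
          right_inv _ := rfl }

/-- The image of a section of the projection to a right transversal is a right transversal. -/
theorem range_of_section (hT : IsComplement (H : Set G) T) (t : T → G)
    (ht : ∀ a, (hT.equiv (t a)).2 = a) : IsComplement (H : Set G) (Set.range t) := by
  rw [isComplement_iff_existsUnique_mul_inv_mem]
  have mem_iff : ∀ g a, g * (t a)⁻¹ ∈ H ↔ a = (hT.equiv g).2 := fun g a ↦ by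
    conv_rhs => rw [← ht a, hT.equiv_snd_eq_iff_rightCosetEquivalence, RightCosetEquivalence,
      rightCoset_eq_iff]
  refine fun g ↦ ⟨⟨t (hT.equiv g).2, _, rfl⟩, (mem_iff _ _).2 rfl, ?_⟩
  rintro ⟨_, a, rfl⟩ ha
  exact Subtype.ext (congrArg t ((mem_iff _ _).1 ha))

end Subgroup.IsComplement

/-- An inverse-closed double coset of `H` with an odd number of right cosets of `H` contains an
element equal to its inverse, provided that `H` has a subgroup of odd index with an inverse-closed
right transversal. -/
theorem exists_inv_eq_self_of_odd {G β : Type*} [Group G] [Finite G] {H K : Subgroup G}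
    (hKH : K ≤ H) (hodd : Odd (K.relIndex H)) (hK : K.IsPerfectCode) {T : Set G}
    (hT : IsComplement (H : Set G) T) (p : G → β) (hp : ∀ h ∈ H, ∀ g, p (h * g) = p g) {b : β}
    (hb : ∀ g, p g = b → p g⁻¹ = b) (hbodd : Odd (Nat.card {t : T // p t = b})) :
    ∃ g, g⁻¹ = g ∧ p g = b := by
  obtain ⟨S, hS, hKS⟩ := hK
  have hcard := (hKS.card_fibre_eq_mul p (fun k hk ↦ hp k (hKH hk)) b).symm.trans
    (hT.card_fibre_eq_mul p hp b)
  rw [← relIndex_bot_left H, ← relIndex_mul_relIndex ⊥ K H bot_le hKH, relIndex_bot_left,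
    mul_assoc] at hcard
  have hSodd : Odd (Nat.card {s : S // p s = b}) :=
    Nat.eq_of_mul_eq_mul_left Nat.card_pos hcard ▸ hodd.mul hbodd
  let f : {s : S // p s = b} → {s : S // p s = b} := fun s ↦
    ⟨⟨(s : G)⁻¹, by rw [← Set.mem_inv, hS]; exact s.1.2⟩, hb _ s.2⟩
  have hf : Involutive f := fun s ↦ by simp [f]
  have := Fintype.ofFinite {s : S // p s = b}
  rw [Nat.card_eq_fintype_card] at hSodd
  obtain ⟨s, hs⟩ := Equiv.Perm.exists_fixed_point_of_prime (p := 2) (n := 1)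
    hSodd.not_two_dvd_nat (σ := hf.toPerm) (by
      ext s
      simp [sq, hf s])
  exact ⟨s, congrArg (fun s : {s : S // p s = b} ↦ (s : G)) hs, s.2⟩

/-- A subgroup having a perfect code of the ambient group as a subgroup of odd index is itself a
perfect code. -/
theorem Subgroup.IsPerfectCode.of_le_of_odd_relIndex {G : Type*} [Group G] [Finite G]
    {H K : Subgroup G} (hK : K.IsPerfectCode) (hKH : K ≤ H) (hodd : Odd (K.relIndex H)) :
    H.IsPerfectCode := by
  obtain ⟨T, hT, -⟩ := H.exists_isComplement_right 1
  let p : G → Set G := fun g ↦ DoubleCoset.doubleCoset g H H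
  have p_eq : ∀ {g g'}, p g = p g' ↔ ∃ a ∈ H, ∃ b ∈ H, g' = a * g * b := DoubleCoset.rel_iff
  have hp : ∀ h ∈ H, ∀ g, p (h * g) = p g := fun h hh g ↦
    (p_eq.2 ⟨h, hh, 1, H.one_mem, by simp⟩).symm
  have hp_inv : ∀ g, p g⁻¹ = (p g)⁻¹ := fun g ↦ by
    simp only [p, DoubleCoset.doubleCoset, mul_inv_rev, Set.inv_singleton, inv_coe_set, mul_assoc]
  have hp_snd : ∀ g, p (hT.equiv g).2 = p g := fun g ↦ by
    conv_rhs => rw [← hT.equiv_fst_mul_equiv_snd g]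
    exact (hp _ (hT.equiv g).1.2 _).symm
  obtain ⟨σ, hσ, hpσ, hfix⟩ := exists_involutive_lift (fun t : T ↦ p t)
    (inv_involutive (G := Set G))
    (fun t ↦ ∃ g, g⁻¹ = g ∧ (hT.equiv g).2 = t)
    (fun b ↦ by
      refine Nat.eq_of_mul_eq_mul_left (Nat.card_pos (α := H)) ?_
      rw [← hT.card_fibre_eq_mul p hp, ← hT.card_fibre_eq_mul p hp]
      exact Nat.card_congr ((Equiv.inv G).subtypeEquiv fun g ↦ by simp [hp_inv]))
    (fun b hb hbodd ↦ by
      obtain ⟨g, hg, hgb⟩ := exists_inv_eq_self_of_odd hKH hodd hK hT p hp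
        (fun g hg ↦ by rw [hp_inv, hg, hb]) hbodd
      exact ⟨_, (hp_snd g).trans hgb, g, hg, rfl⟩)
  obtain ⟨t, ht, htσ⟩ := exists_section_inv (fun g ↦ (hT.equiv g).2) hσ
    (fun a ↦ by
      obtain ⟨h, hh, k, hk, e⟩ := p_eq.1 ((hp_inv a).trans (hpσ a).symm)
      have snd_eq : ∀ x ∈ H, ∀ s : T, (hT.equiv (x * s)).2 = s := fun x hx s ↦
        congrArg Prod.snd (hT.equiv.apply_symm_apply (⟨x, hx⟩, s))
      refine ⟨k⁻¹ * a, snd_eq _ (H.inv_mem hk) a, ?_⟩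
      rw [← snd_eq _ (H.inv_mem hh) (σ a), e]
      simp [mul_assoc])
    hfix
  refine ⟨Set.range t, ?_, hT.range_of_section t ht⟩
  ext g
  constructor
  · rintro ⟨a, ha⟩
    exact ⟨σ a, by rw [htσ, ha, inv_inv]⟩
  · rintro ⟨a, rfl⟩
    exact ⟨σ a, htσ a⟩

theorem isPerfectCode_of_sylow_two_isPerfectCode {G : Type*} [Group G] [Finite G]
    (H : Subgroup G)
    (h : ∃ Q : Sylow 2 H, ((Q : Subgroup H).map H.subtype).IsPerfectCode) :
    H.IsPerfectCode := by
  obtain ⟨Q, hQ⟩ := h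
  refine hQ.of_le_of_odd_relIndex (map_subtype_le _) ?_
  rw [relIndex, ← comap_subtype, comap_map_eq_self_of_injective H.subtype_injective]
  exact Nat.not_even_iff_odd.1 fun h ↦ Q.not_dvd_index h.two_dvd
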